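/- Let (G,ψ) be a vertex-weighted digraph on [ℓ] and let v be a king of G. Let (G″,ψ″) be obtained from (G,ψ) by the king elimination operation with respect to v. If Condition (K) with respect to v is satisfied, then the ψ-digraphical arrangements A(G,ψ) and A(G″,ψ″) have the same characteristic polynomial: χ_{A(G,ψ)}(t) = χ_{A(G″,ψ″)}(t). -/

import Mathlib

open scoped Classical
open Finset

noncomputable section

namespace Paper

variable {ι : Type}

/-- The intersection of a finite collection of subsets of `ι → ℝ`
(the empty intersection being the whole space). -/
def inter (B : Finset (Set (ι → ℝ))) : Set (ι → ℝ) := ⋂ H ∈ B, H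

/-- The intersection poset `L(A)` of an arrangement `A`: all nonempty intersections
of subcollections of `A` (including the whole space as the empty intersection),
ordered by reverse inclusion. -/
def L (A : Finset (Set (ι → ℝ))) : Finset (Set (ι → ℝ)) :=
  (A.powerset.image inter).filter fun X => X.Nonempty

/-- The dimension of a subset of `ι → ℝ` (as the dimension of the direction of
its affine span). -/
def dim (X : Set (ι → ℝ)) : ℕ := Module.finrank ℝ (affineSpan ℝ X).direction

/-- The elements of `L A` lying strictly above `X` in the intersection poset,
i.e. the sets `Y ∈ L A` with `Y ⊋ X`. -/
def above (A : Finset (Set (ι → ℝ))) (X : Set (ι → ℝ)) : Finset (Set (ι → ℝ)) :=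
  (L A).filter fun Y => X ⊂ Y

lemma above_lt {A : Finset (Set (ι → ℝ))} {X Y : Set (ι → ℝ)}
    (hY : Y ∈ above A X) : (above A Y).card < (above A X).card := by
  have hY' := Finset.mem_filter.mp hY
  apply Finset.card_lt_card
  rw [Finset.ssubset_iff_of_subset]
  · refine ⟨Y, hY, ?_⟩
    simp only [above, Finset.mem_filter, not_and]
    exact fun _ => ssubset_irrefl Y
  · intro Z hZ
    have hZ' := Finset.mem_filter.mp hZ
    exact Finset.mem_filter.mpr ⟨hZ'.1, hY'.2.trans hZ'.2⟩

/-- The Möbius function of the intersection poset: `μ(whole space) = 1`, and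
`μ(X) = - ∑_{Y ⊋ X} μ(Y)`. -/
def mob (A : Finset (Set (ι → ℝ))) (X : Set (ι → ℝ)) : ℤ :=
  if X = Set.univ then 1
  else - ∑ Y ∈ (above A X).attach, mob A Y.1
termination_by (above A X).card
decreasing_by exact above_lt Y.2

/-- The characteristic polynomial `χ_A(t) = ∑_{X ∈ L(A)} μ(X) t^{dim X}`. -/
def charPoly (A : Finset (Set (ι → ℝ))) : Polynomial ℤ :=
  ∑ X ∈ L A, Polynomial.C (mob A X) * Polynomial.X ^ dim X

/-- The localization `B_X = {H ∈ B : X ⊆ H}`. -/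
def loc (B : Finset (Set (ι → ℝ))) (X : Set (ι → ℝ)) : Finset (Set (ι → ℝ)) :=
  B.filter fun H => X ⊆ H

open Pointwise in
/-- `X` is a modular element of `L(B)`: `X ∈ L(B)` and `X + Y ∈ L(B)` for all `Y ∈ L(B)`. -/
def IsModular (B : Finset (Set (ι → ℝ))) (X : Set (ι → ℝ)) : Prop :=
  X ∈ L B ∧ ∀ Y ∈ L B, X + Y ∈ L B

/-- The rank of an arrangement: maximal codimension of an element of `L(B)`. -/
def rank [Fintype ι] (B : Finset (Set (ι → ℝ))) : ℕ :=
  (L B).sup fun X => Fintype.card ι - dim X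

/-- A modular coatom: a modular element of codimension `rank B - 1`. -/
def IsModularCoatom [Fintype ι] (B : Finset (Set (ι → ℝ))) (X : Set (ι → ℝ)) : Prop :=
  IsModular B X ∧ Fintype.card ι - dim X = rank B - 1

/-- A central arrangement is supersolvable if there is a chain of localizations
`∅ = B_{X_0} ⊆ B_{X_1} ⊆ ⋯ ⊆ B_{X_r} = B` (`r = rank B`) in which each `X_i` is a
modular coatom of `B_{X_{i+1}}`. -/
def IsSupersolvable [Fintype ι] (B : Finset (Set (ι → ℝ))) : Prop :=
  ∃ X : Fin (rank B + 1) → Set (ι → ℝ),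
    loc B (X 0) = ∅ ∧ loc B (X (Fin.last (rank B))) = B ∧
    (∀ i j : Fin (rank B + 1), i ≤ j → loc B (X i) ⊆ loc B (X j)) ∧
    ∀ i : Fin (rank B), IsModularCoatom (loc B (X i.succ)) (X i.castSucc)

/-- The polynomial ring `S = ℝ[x_i : i ∈ ι]`. -/
abbrev S (ι : Type) := MvPolynomial ι ℝ

/-- Derivations of `S` over `ℝ`. -/
abbrev Der (ι : Type) := Derivation ℝ (S ι) (S ι)

/-- The linear polynomial `∑ c_i x_i`. -/
def linPoly [Fintype ι] (c : ι → ℝ) : S ι := ∑ i, MvPolynomial.C (c i) * MvPolynomial.X i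

/-- The linear hyperplane `{x : ∑ c_i x_i = 0}`. -/
def linHyp [Fintype ι] (c : ι → ℝ) : Set (ι → ℝ) := {x | ∑ i, c i * x i = 0}

/-- `θ` is a logarithmic derivation of the central arrangement `B`:
`θ(α_H) ∈ α_H S` for every defining linear form `α_H` of every `H ∈ B`. -/
def IsLogDer [Fintype ι] (B : Finset (Set (ι → ℝ))) (θ : Der ι) : Prop :=
  ∀ c : ι → ℝ, c ≠ 0 → linHyp c ∈ B → linPoly c ∣ θ (linPoly c)

/-- A derivation `θ = ∑ f_j ∂/∂x_j` is homogeneous of degree `d` if every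
coefficient `f_j = θ(x_j)` is homogeneous of degree `d`. -/
def IsHomog (θ : Der ι) (d : ℕ) : Prop :=
  ∀ j : ι, MvPolynomial.IsHomogeneous (θ (MvPolynomial.X j)) d

/-- `B` is free with exponents `d`: `D(B)` is a free `S`-module with a homogeneous
basis `θ_i`, `i ∈ ι`, of degrees `d_i`. -/
def IsFreeWith [Fintype ι] (B : Finset (Set (ι → ℝ))) (d : ι → ℕ) : Prop :=
  ∃ θ : ι → Der ι,
    (∀ i, IsLogDer B (θ i)) ∧ (∀ i, IsHomog (θ i) (d i)) ∧
    ∀ η : Der ι, IsLogDer B η → ∃! f : ι → S ι, η = ∑ i, f i • θ i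

/-- `B` is a free arrangement. -/
def IsFree [Fintype ι] (B : Finset (Set (ι → ℝ))) : Prop := ∃ d : ι → ℕ, IsFreeWith B d

/-- Logarithmic derivation of a multiarrangement `(B, mult)`:
`θ(α_H) ∈ α_H^{mult H} S` for every `H ∈ B`. -/
def IsLogDerMulti [Fintype ι] (B : Finset (Set (ι → ℝ))) (mult : Set (ι → ℝ) → ℕ)
    (θ : Der ι) : Prop :=
  ∀ c : ι → ℝ, c ≠ 0 → linHyp c ∈ B → linPoly c ^ mult (linHyp c) ∣ θ (linPoly c)

/-- Freeness of the multiarrangement `(B, mult)`: `D(B, mult)` is a free `S`-module. -/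
def IsFreeMulti [Fintype ι] (B : Finset (Set (ι → ℝ))) (mult : Set (ι → ℝ) → ℕ) : Prop :=
  ∃ θ : ι → Der ι,
    (∀ i, IsLogDerMulti B mult (θ i)) ∧
    ∀ η : Der ι, IsLogDerMulti B mult η → ∃! f : ι → S ι, η = ∑ i, f i • θ i

/-- `B` is locally free in codimension three along the hyperplane `H`:
every localization at an `X ∈ L(B)` with `X ⊆ H` of codimension 3 is free. -/
def LocallyFree3 [Fintype ι] (B : Finset (Set (ι → ℝ))) (H : Set (ι → ℝ)) : Prop :=
  ∀ X ∈ L B, X ⊆ H → Fintype.card ι - dim X = 3 → IsFree (loc B X)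

/-- The ψ-digraphical arrangement `A(G, ψ)` of the digraph with edge set `E` on the
vertex set `ι` and weight `ψ(i) = [a i, b i]`:  hyperplanes `x_i - x_j = 0` for all
distinct `i, j`, `x_i - x_j = 1` for `(i,j) ∈ E`, and `x_i = c` for `c ∈ [a i, b i]`. -/
def digArr [Fintype ι] (E : Finset (ι × ι)) (a b : ι → ℤ) : Finset (Set (ι → ℝ)) :=
  ((univ.filter fun p : ι × ι => p.1 ≠ p.2).image fun p =>
      {x : ι → ℝ | x p.1 - x p.2 = 0})
  ∪ (E.image fun p => {x : ι → ℝ | x p.1 - x p.2 = 1})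
  ∪ (univ.biUnion fun i : ι =>
      (Finset.Icc (a i) (b i)).image fun c => {x : ι → ℝ | x i = (c : ℝ)})

/-- The cone `cA(G, ψ)` over the ψ-digraphical arrangement, a central arrangement in
`ℝ^{ℓ+1}` with coordinates indexed by `Option ι` (the coordinate `z` being `x none`). -/
def coneDigArr [Fintype ι] (E : Finset (ι × ι)) (a b : ι → ℤ) :
    Finset (Set (Option ι → ℝ)) :=
  ({({x : Option ι → ℝ | x none = 0})} : Finset (Set (Option ι → ℝ)))
  ∪ ((univ.filter fun p : ι × ι => p.1 ≠ p.2).image fun p =>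
      {x : Option ι → ℝ | x (some p.1) - x (some p.2) = 0})
  ∪ (E.image fun p => {x : Option ι → ℝ | x (some p.1) - x (some p.2) = x none})
  ∪ (univ.biUnion fun i : ι =>
      (Finset.Icc (a i) (b i)).image fun c =>
        {x : Option ι → ℝ | x (some i) = (c : ℝ) * x none})

/-- The restriction of the edge set `E` to the vertex set `ι ∖ {v}`. -/
def Eres (E : Finset (ι × ι)) (v : ι) :
    Finset ({i : ι // i ≠ v} × {i : ι // i ≠ v}) :=
  ((E.filter fun e => e.1 ≠ v ∧ e.2 ≠ v).attach).image fun e =>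
    (⟨e.1.1, (Finset.mem_filter.mp e.2).2.1⟩, ⟨e.1.2, (Finset.mem_filter.mp e.2).2.2⟩)

/-- The element `X_v ∈ L(cA(G,ψ))`: the intersection of `z = 0`, `x_i - x_j = 0`
(`i, j ≠ v`), `x_i - x_j = z` (edges `(i,j)` with `i, j ≠ v`) and `x_i = cz`
(`i ≠ v`, `c ∈ ψ(i)`). -/
def Xv (E : Finset (ι × ι)) (a b : ι → ℤ) (v : ι) : Set (Option ι → ℝ) :=
  {x | x none = 0 ∧
    (∀ i j : ι, i ≠ v → j ≠ v → x (some i) - x (some j) = 0) ∧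
    (∀ p ∈ E, p.1 ≠ v → p.2 ≠ v → x (some p.1) - x (some p.2) = x none) ∧
    (∀ i : ι, i ≠ v → ∀ c ∈ Finset.Icc (a i) (b i), x (some i) = (c : ℝ) * x none)}

/-- `v` is a simplicial vertex of `(G, ψ)`: `X_v` is a modular coatom of `cA(G,ψ)`. -/
def Simplicial [Fintype ι] (E : Finset (ι × ι)) (a b : ι → ℤ) (v : ι) : Prop :=
  IsModularCoatom (coneDigArr E a b) (Xv E a b v)

/-- Restriction of a subset of the cone space to the infinite hyperplane `z = 0`,
identified with `ι → ℝ`. -/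
def resH (K : Set (Option ι → ℝ)) : Set (ι → ℝ) :=
  {y | (fun o : Option ι => Option.elim o 0 y) ∈ K}

/-- Embedding of a subset of the infinite hyperplane back into the cone space. -/
def embedH (Y : Set (ι → ℝ)) : Set (Option ι → ℝ) :=
  {x | x none = 0 ∧ (fun i : ι => x (some i)) ∈ Y}

/-- The underlying arrangement of the Ziegler restriction of `B` onto the infinite
hyperplane `z = 0`. -/
def zieglerArr (B : Finset (Set (Option ι → ℝ))) : Finset (Set (ι → ℝ)) :=
  (B.erase {x | x none = 0}).image resH

/-- The Ziegler multiplicity `m^{H_∞}(X) = |{K ∈ B : X ⊆ K}| - 1`. -/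
def zieglerMult (B : Finset (Set (Option ι → ℝ))) (Y : Set (ι → ℝ)) : ℕ :=
  (B.filter fun K => embedH Y ⊆ K).card - 1

/-- The (k,ℓ)-Shi-Ish arrangement in `ℝ^ℓ` (0-based vertices `0,…,ℓ-1` standing
for the labels `1,…,ℓ`). -/
def ShiIsh (ℓ k : ℕ) : Finset (Set (Fin ℓ → ℝ)) :=
  ((univ.filter fun p : Fin ℓ × Fin ℓ => p.1 < p.2).image fun p =>
      {x : Fin ℓ → ℝ | x p.1 - x p.2 = 0})
  ∪ ((univ.filter fun p : Fin ℓ × Fin ℓ => p.1 < p.2 ∧ k ≤ (p.1 : ℕ) + 1).image fun p =>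
      {x : Fin ℓ → ℝ | x p.1 - x p.2 = 1})
  ∪ ((univ.filter fun p : Fin ℓ × Fin ℓ => (p.1 : ℕ) = 0).biUnion fun p =>
      ((Finset.Icc 1 ((p.2 : ℕ))).filter fun c => c < k).image fun c =>
        {x : Fin ℓ → ℝ | x p.1 - x p.2 = (c : ℝ)})

/-- The cone over the (k,ℓ)-Shi-Ish arrangement, a central arrangement in `ℝ^{ℓ+1}`
with coordinates indexed by `Option (Fin ℓ)` (the coordinate `z` being `x none`). -/
def cShiIsh (ℓ k : ℕ) : Finset (Set (Option (Fin ℓ) → ℝ)) :=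
  ({({x : Option (Fin ℓ) → ℝ | x none = 0})} : Finset (Set (Option (Fin ℓ) → ℝ)))
  ∪ ((univ.filter fun p : Fin ℓ × Fin ℓ => p.1 < p.2).image fun p =>
      {x : Option (Fin ℓ) → ℝ | x (some p.1) - x (some p.2) = 0})
  ∪ ((univ.filter fun p : Fin ℓ × Fin ℓ => p.1 < p.2 ∧ k ≤ (p.1 : ℕ) + 1).image fun p =>
      {x : Option (Fin ℓ) → ℝ | x (some p.1) - x (some p.2) = x none})
  ∪ ((univ.filter fun p : Fin ℓ × Fin ℓ => (p.1 : ℕ) = 0).biUnion fun p =>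
      ((Finset.Icc 1 ((p.2 : ℕ))).filter fun c => c < k).image fun c =>
        {x : Option (Fin ℓ) → ℝ | x (some p.1) - x (some p.2) = (c : ℝ) * x none})

/-- The digraph `T_ℓ^k` on `ℓ` 0-based vertices, with edges `(i,j)` for `i < j`
with label `(j : ℕ) + 1 ≤ ℓ - k + 1`. -/
def Tlk (ℓ k : ℕ) : Finset (Fin ℓ × Fin ℓ) :=
  univ.filter fun p : Fin ℓ × Fin ℓ => p.1 < p.2 ∧ (p.2 : ℕ) + 1 ≤ ℓ - k + 1

/-- The lower endpoint of the weight `ψ_ℓ^k(i) = [-min(ℓ-i+1, k), 0]`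
(0-based vertex `i` standing for the label `i+1`, so `ℓ - label + 1 = ℓ - i`). -/
def psiLk (ℓ k : ℕ) (i : Fin ℓ) : ℤ := -(min (ℓ - (i : ℕ)) k : ℤ)

end Paper

namespace Paper

/-! ### Evaluating the characteristic polynomial by counting points -/

lemma mem_L_image {κ : Type} {K : Finset κ} {h : κ → Set (ι → ℝ)} {X : Set (ι → ℝ)} :
    X ∈ L (K.image h) ↔ X.Nonempty ∧ ∃ B ⊆ K, X = ⋂ k ∈ B, h k := by
  simp only [L, inter, Finset.mem_filter, Finset.mem_image, Finset.mem_powerset]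
  constructor
  · rintro ⟨⟨C, hC, rfl⟩, hX⟩
    obtain ⟨B, hB, rfl⟩ := Finset.subset_image_iff.mp hC
    exact ⟨hX, B, hB, by simp⟩
  · rintro ⟨hX, B, hB, rfl⟩
    exact ⟨⟨B.image h, Finset.image_subset_image hB, by simp⟩, hX⟩

lemma sum_mob {A : Finset (Set (ι → ℝ))} {F : Set (ι → ℝ)} (hF : F ∈ L A) :
    ∑ X ∈ L A with F ⊆ X, mob A X = if F = Set.univ then 1 else 0 := by
  split_ifs with h
  · subst h
    have : (L A).filter (fun X => Set.univ ⊆ X) = {Set.univ} := by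
      ext X
      simp only [Finset.mem_filter, Set.univ_subset_iff, Finset.mem_singleton]
      exact ⟨fun h => h.2, fun h => ⟨h ▸ hF, h⟩⟩
    rw [this, Finset.sum_singleton, mob, if_pos rfl]
  · have : (L A).filter (fun X => F ⊆ X) = insert F (above A F) := by
      ext X
      simp only [above, Finset.mem_filter, Finset.mem_insert, Set.ssubset_iff_subset_ne]
      constructor
      · rintro ⟨h1, h2⟩
        by_cases h3 : F = X
        · exact Or.inl h3.symm
        · exact Or.inr ⟨h1, h2, h3⟩
      · rintro (rfl | ⟨h1, h2, -⟩)
        · exact ⟨hF, subset_rfl⟩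
        · exact ⟨h1, h2⟩
    rw [this, Finset.sum_insert (by simp [above]), mob, if_neg h,
      Finset.sum_attach (above A F) (mob A)]
    ring

/-- If a family `g` of subsets of a finite set `P` has intersections of the same sizes as the
intersections of the hyperplanes `h k` would have over a field with `q` elements, then the
characteristic polynomial evaluated at `q` counts the points of `P` outside all `g k`. -/
lemma charPoly_eval_eq_card {κ P : Type} [Fintype P] (K : Finset κ) (h : κ → Set (ι → ℝ))
    (g : κ → Set P) (q : ℕ) (hne : ∀ k ∈ K, h k ≠ Set.univ)
    (hcard : ∀ B ⊆ K, (univ.filter fun p => ∀ k ∈ B, p ∈ g k).card =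
      if (⋂ k ∈ B, h k).Nonempty then q ^ dim (⋂ k ∈ B, h k) else 0) :
    (charPoly (K.image h)).eval (q : ℤ) = (univ.filter fun p => ∀ k ∈ K, p ∉ g k).card := by
  have hloc : ∀ X ∈ L (K.image h), X = ⋂ k ∈ K.filter (fun k => X ⊆ h k), h k := by
    intro X hX
    obtain ⟨-, B, hB, rfl⟩ := mem_L_image.mp hX
    apply Set.Subset.antisymm
    · exact Set.subset_iInter₂ fun k hk => (Finset.mem_filter.mp hk).2
    · refine Set.subset_iInter₂ fun k hk => Set.biInter_subset_of_mem ?_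
      exact Finset.mem_coe.mpr (Finset.mem_filter.mpr ⟨hB hk, Set.biInter_subset_of_mem hk⟩)
  have hX : ∀ X ∈ L (K.image h), ((q : ℤ) ^ dim X) =
      ∑ p : P, if ∀ k ∈ K.filter (fun k => X ⊆ h k), p ∈ g k then 1 else 0 := by
    intro X hX
    have := hcard (K.filter fun k => X ⊆ h k) (Finset.filter_subset _ _)
    rw [← hloc X hX, if_pos (mem_L_image.mp hX).1] at this
    rw [Finset.sum_boole, this]
    push_cast
    rfl
  have hp : ∀ p : P, (∑ X ∈ L (K.image h), mob (K.image h) X *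
      if ∀ k ∈ K.filter (fun k => X ⊆ h k), p ∈ g k then 1 else 0) =
      if ∀ k ∈ K, p ∉ g k then 1 else 0 := by
    intro p
    set Bp := K.filter fun k => p ∈ g k with hBp
    have hBK : Bp ⊆ K := Finset.filter_subset _ _
    set F := ⋂ k ∈ Bp, h k with hF
    have hpB : p ∈ univ.filter fun p => ∀ k ∈ Bp, p ∈ g k := by
      simp [hBp]
    have hFne : F.Nonempty := by
      by_contra hcon
      have := hcard Bp hBK
      rw [if_neg hcon, Finset.card_eq_zero] at this
      rw [this] at hpB
      simp at hpB
    have hFL : F ∈ L (K.image h) := mem_L_image.mpr ⟨hFne, Bp, hBK, rfl⟩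
    have hiff : ∀ X ∈ L (K.image h),
        ((∀ k ∈ K.filter (fun k => X ⊆ h k), p ∈ g k) ↔ F ⊆ X) := by
      intro X hX
      constructor
      · intro hk
        rw [hloc X hX]
        refine Set.subset_iInter₂ fun k hk' => Set.biInter_subset_of_mem ?_
        exact Finset.mem_coe.mpr
          (Finset.mem_filter.mpr ⟨(Finset.mem_filter.mp hk').1, hk k hk'⟩)
      · intro hFX k hk
        obtain ⟨hkK, hXk⟩ := Finset.mem_filter.mp hk
        have hins : (⋂ j ∈ insert k Bp, h j) = F := by
          rw [Finset.set_biInter_insert]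
          exact Set.inter_eq_right.mpr (hFX.trans hXk)
        have h1 := hcard (insert k Bp) (Finset.insert_subset hkK hBK)
        rw [hins, ← hcard Bp hBK] at h1
        have h2 := Finset.eq_of_subset_of_card_le
          (s := univ.filter fun p => ∀ j ∈ insert k Bp, p ∈ g j)
          (t := univ.filter fun p => ∀ j ∈ Bp, p ∈ g j)
          (Finset.monotone_filter_right _
            fun p _ hp j hj => hp j (Finset.mem_insert_of_mem hj)) h1.ge
        rw [← h2] at hpB
        exact (Finset.mem_filter.mp hpB).2 k (Finset.mem_insert_self _ _)
    have hFuniv : F = Set.univ ↔ ∀ k ∈ K, p ∉ g k := by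
      constructor
      · intro hu k hk hpk
        refine hne k hk (Set.univ_subset_iff.mp ?_)
        rw [← hu]
        exact Set.biInter_subset_of_mem (Finset.mem_coe.mpr (Finset.mem_filter.mpr ⟨hk, hpk⟩))
      · intro hk
        have : Bp = ∅ := Finset.filter_eq_empty_iff.mpr fun k hk' => hk k hk'
        simp [hF, this]
    rw [← if_congr hFuniv rfl rfl, ← sum_mob hFL, Finset.sum_filter]
    refine Finset.sum_congr rfl fun X hX => ?_
    rw [if_congr (hiff X hX) rfl rfl, mul_ite, mul_one, mul_zero]
  rw [charPoly, Polynomial.eval_finsetSum]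
  simp only [Polynomial.eval_mul, Polynomial.eval_C, Polynomial.eval_pow, Polynomial.eval_X]
  rw [Finset.sum_congr rfl fun X h => by rw [hX X h, Finset.mul_sum], Finset.sum_comm,
    Finset.sum_congr rfl fun p _ => hp p, Finset.sum_boole]

/-! ### Systems of difference equations -/

/-- Extension of a point by a coordinate `none` with value `0`. -/
def extend {R : Type} [CommRing R] (x : ι → R) : Option ι → R := fun o => o.elim 0 x

/-- The equation `x_i - x_j = c` encoded by the triple `(i, j, c)`. -/
def Sat {R : Type} [CommRing R] (k : Option ι × Option ι × ℤ) (x : Option ι → R) : Prop :=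
  x k.1 = x k.2.1 + (k.2.2 : R)

/-- A solved form `x_o = x_{f o} + w_o` of a system of difference equations. -/
structure IsSolved (f : Option ι → Option ι) (w : Option ι → ℤ) : Prop where
  map_none : f none = none
  idem : ∀ o, f (f o) = f o
  weight : ∀ o, w (f o) = 0

/-- `x` solves the solved form given by `f` and `w`. -/
def Solves {R : Type} [CommRing R] (f : Option ι → Option ι) (w : Option ι → ℤ)
    (x : Option ι → R) : Prop := ∀ o, x o = x (f o) + (w o : R)

lemma IsSolved.merge {f : Option ι → Option ι} {w : Option ι → ℤ} (hf : IsSolved f w)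
    {r s : Option ι} (hr : f r = r) (hs : f s = s) (hrs : r ≠ s) (hr0 : r ≠ none) (d : ℤ) :
    ∃ f' w', IsSolved f' w' ∧ ∀ (R : Type) [CommRing R] (x : Option ι → R),
      (x r = x s + (d : R) ∧ Solves f w x) ↔ Solves f' w' x := by
  have hwr : w r = 0 := by rw [← hr]; exact hf.weight r
  have hws : w s = 0 := by rw [← hs]; exact hf.weight s
  refine ⟨fun o => if f o = r then s else f o, fun o => if f o = r then w o + d else w o,
    ⟨?_, ?_, ?_⟩, ?_⟩
  · simp [hf.map_none, hr0.symm]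
  · intro o
    by_cases h : f o = r
    · simp [h, hs, hrs.symm]
    · simp [h, hf.idem]
  · intro o
    by_cases h : f o = r
    · simp [h, hs, hrs.symm, hws]
    · simp [h, hf.idem, hf.weight]
  · intro R _ x
    constructor
    · rintro ⟨h1, h2⟩ o
      by_cases h : f o = r
      · simp only [h, if_true]
        rw [h2 o, h, h1]
        push_cast
        ring
      · simpa only [h, if_false] using h2 o
    · intro h
      have h1 : x r = x s + (d : R) := by simpa [hr, hwr] using h r
      refine ⟨h1, fun o => ?_⟩
      have h2 := h o
      by_cases h' : f o = r
      · simp only [h', if_true] at h2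
        rw [h2, h', h1]
        push_cast
        ring
      · simpa only [h', if_false] using h2

/-- A system of difference equations either has a solved form, valid over every ring, or implies
that some nonzero integer vanishes. -/
lemma exists_solved_form (B : Finset (Option ι × Option ι × ℤ)) :
    (∃ f w, IsSolved f w ∧ ∀ (R : Type) [CommRing R] (x : Option ι → R),
      (∀ k ∈ B, Sat k x) ↔ Solves f w x) ∨
    ∃ m : ℤ, m ≠ 0 ∧ ∀ (R : Type) [CommRing R] (x : Option ι → R),
      (∀ k ∈ B, Sat k x) → (m : R) = 0 := by
  induction B using Finset.induction_on with
  | empty =>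
    exact Or.inl ⟨id, fun _ => 0, ⟨rfl, fun _ => rfl, fun _ => rfl⟩, by simp [Solves]⟩
  | insert k B _ ih =>
    obtain ⟨f, w, hf, hB⟩ | ⟨m, hm, h⟩ := ih
    swap
    · exact Or.inr ⟨m, hm, fun R _ x hx => h R x fun j hj => hx j (Finset.mem_insert_of_mem hj)⟩
    obtain ⟨i, j, c⟩ := k
    set d : ℤ := c - w i + w j with hd
    have key : ∀ (R : Type) [CommRing R] (x : Option ι → R), Solves f w x →
        (Sat (i, j, c) x ↔ x (f i) = x (f j) + (d : R)) := by
      intro R _ x hx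
      simp only [Sat]
      rw [hx i, hx j, hd]
      push_cast
      constructor <;> intro h <;> linear_combination h
    have hins : ∀ (R : Type) [CommRing R] (x : Option ι → R),
        (∀ k ∈ insert (i, j, c) B, Sat k x) ↔
          (x (f i) = x (f j) + (d : R) ∧ Solves f w x) := by
      intro R _ x
      rw [Finset.forall_mem_insert, hB R x]
      exact and_congr_left fun hx => key R x hx
    by_cases hij : f i = f j
    · by_cases hd0 : d = 0
      · refine Or.inl ⟨f, w, hf, fun R _ x => ?_⟩
        rw [hins, hij, hd0]
        simp
      · refine Or.inr ⟨d, hd0, fun R _ x hx => ?_⟩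
        have := ((hins R x).mp hx).1
        rw [hij] at this
        simpa using this
    · refine Or.inl ?_
      by_cases hi : f i = none
      · have hj : f j ≠ none := fun h => hij (hi.trans h.symm)
        obtain ⟨f', w', hf', h'⟩ := hf.merge (hf.idem j) (hf.idem i) (Ne.symm hij) hj (-d)
        refine ⟨f', w', hf', fun R _ x => ?_⟩
        rw [hins, ← h']
        refine and_congr_left fun _ => ?_
        push_cast
        constructor <;> intro h <;> linear_combination -h
      · obtain ⟨f', w', hf', h'⟩ := hf.merge (hf.idem i) (hf.idem j) hij hi d
        exact ⟨f', w', hf', fun R _ x => by rw [hins, ← h']⟩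

/-- The linear part of the parametrization of the solutions of a solved form by the values at the
fixed points of `f`. -/
def solvedParam (R : Type) [CommRing R] (f : Option ι → Option ι) :
    ({i : ι // f (some i) = some i} → R) →ₗ[R] (ι → R) where
  toFun y i := (f (some i)).elim 0 fun j => if h : f (some j) = some j then y ⟨j, h⟩ else 0
  map_add' y z := by
    ext i
    simp only [Pi.add_apply]
    rcases f (some i) with _ | j
    · simp
    · by_cases h : f (some j) = some j <;> simp [h]
  map_smul' r y := by
    ext i
    simp only [Pi.smul_apply, RingHom.id_apply]
    rcases f (some i) with _ | j
    · simp
    · by_cases h : f (some j) = some j <;> simp [h]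

lemma solvedParam_apply_fixed {R : Type} [CommRing R] {f : Option ι → Option ι}
    (y : {i : ι // f (some i) = some i} → R) (i : {i : ι // f (some i) = some i}) :
    solvedParam R f y i = y i := by
  obtain ⟨i, hi⟩ := i
  simp [solvedParam, hi]

lemma solvedParam_injective (R : Type) [CommRing R] (f : Option ι → Option ι) :
    Function.Injective (solvedParam R f) := fun y z h => by
  ext i
  rw [← solvedParam_apply_fixed y i, h, solvedParam_apply_fixed]

lemma solves_iff_exists_param {R : Type} [CommRing R] {f : Option ι → Option ι}
    {w : Option ι → ℤ} (hf : IsSolved f w) (x : ι → R) :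
    Solves f w (extend x) ↔ ∃ y, solvedParam R f y + (fun i => (w (some i) : R)) = x := by
  constructor
  · intro h
    refine ⟨fun i => x i, ?_⟩
    ext i
    have h1 := h (some i)
    have h2 := hf.idem (some i)
    simp only [extend, Option.elim_some] at h1
    rw [h1]
    simp only [Pi.add_apply, solvedParam, LinearMap.coe_mk, AddHom.coe_mk]
    rcases hfi : f (some i) with _ | j
    · simp
    · rw [hfi] at h2
      simp [h2]
  · rintro ⟨y, rfl⟩ o
    rcases o with _ | i
    · have h := hf.weight none
      rw [hf.map_none] at h
      simp [hf.map_none, h]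
    · have h2 := hf.idem (some i)
      have h3 := hf.weight (some i)
      rcases hfi : f (some i) with _ | j
      · simp [extend, solvedParam, hfi]
      · rw [hfi] at h2 h3
        simp [extend, solvedParam, hfi, h2, h3]

lemma dim_setOf_solves [Fintype ι] {f : Option ι → Option ι} {w : Option ι → ℤ}
    (hf : IsSolved f w) :
    dim {x : ι → ℝ | Solves f w (extend x)} = Fintype.card {i : ι // f (some i) = some i} := by
  have : {x : ι → ℝ | Solves f w (extend x)} =
      (AffineSubspace.mk' (fun i => (w (some i) : ℝ)) (LinearMap.range (solvedParam ℝ f)) :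
        Set (ι → ℝ)) := by
    ext x
    rw [Set.mem_ofPred_eq, solves_iff_exists_param hf, SetLike.mem_coe, AffineSubspace.mem_mk',
      LinearMap.mem_range]
    simp only [vsub_eq_sub, eq_sub_iff_add_eq]
  rw [dim, this, AffineSubspace.affineSpan_coe, AffineSubspace.direction_mk',
    LinearMap.finrank_range_of_inj (solvedParam_injective ℝ f), Module.finrank_fintype_fun_eq_card]

lemma setOf_solves_nonempty {f : Option ι → Option ι} {w : Option ι → ℤ} (hf : IsSolved f w) :
    {x : ι → ℝ | Solves f w (extend x)}.Nonempty :=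
  ⟨_, (solves_iff_exists_param hf _).mpr ⟨0, rfl⟩⟩

lemma card_solves [Fintype ι] {R : Type} [CommRing R] [Fintype R] {f : Option ι → Option ι}
    {w : Option ι → ℤ} (hf : IsSolved f w) :
    (univ.filter fun x : ι → R => Solves f w (extend x)).card =
      Fintype.card R ^ Fintype.card {i : ι // f (some i) = some i} := by
  rw [← Fintype.card_fun, ← Finset.card_univ, ← Finset.card_image_of_injective univ
    (f := fun y => solvedParam R f y + fun i => (w (some i) : R))
    fun y z h => solvedParam_injective R f (add_right_cancel h)]
  congr 1
  ext x
  simp [solves_iff_exists_param hf]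

/-- For large `q`, a system of difference equations has as many solutions modulo `q` as its real
solution space predicts. -/
lemma exists_card_solutions_eq [Fintype ι] (B : Finset (Option ι × Option ι × ℤ)) :
    ∃ N : ℕ, ∀ q > N, ∀ [NeZero q],
      (univ.filter fun x : ι → ZMod q => ∀ k ∈ B, Sat k (extend x)).card =
      if (⋂ k ∈ B, {x : ι → ℝ | Sat k (extend x)}).Nonempty
        then q ^ dim (⋂ k ∈ B, {x : ι → ℝ | Sat k (extend x)}) else 0 := by
  have hinter : (⋂ k ∈ B, {x : ι → ℝ | Sat k (extend x)}) =
      {x : ι → ℝ | ∀ k ∈ B, Sat k (extend x)} := by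
    ext x
    simp
  rw [hinter]
  obtain ⟨f, w, hf, h⟩ | ⟨m, hm, h⟩ := exists_solved_form B
  · refine ⟨0, fun q _ _ => ?_⟩
    simp only [h]
    rw [if_pos (setOf_solves_nonempty hf), dim_setOf_solves hf, card_solves hf, ZMod.card]
  · refine ⟨m.natAbs, fun q hq _ => ?_⟩
    rw [if_neg, Finset.card_eq_zero, Finset.filter_eq_empty_iff]
    · intro x _ hx
      have h1 := h _ _ hx
      rw [ZMod.intCast_zmod_eq_zero_iff_dvd] at h1
      exact hm (Int.eq_zero_of_dvd_of_natAbs_lt_natAbs h1 (by simpa using hq))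
    · rintro ⟨x, hx⟩
      have h1 := h _ _ hx
      exact hm (by exact_mod_cast h1)

/-- For large `q`, the characteristic polynomial of an arrangement of hyperplanes
`x_i - x_j = c` and `x_i = c` counts the points modulo `q` avoiding the arrangement. -/
lemma exists_charPoly_eval_eq [Fintype ι] (K : Finset (Option ι × Option ι × ℤ))
    (hK : ∀ k ∈ K, ∃ i, k.1 = some i ∧ k.2.1 ≠ some i) :
    ∃ N : ℕ, ∀ q > N, ∀ [NeZero q],
      (charPoly (K.image fun k => {x : ι → ℝ | Sat k (extend x)})).eval (q : ℤ) =
        (univ.filter fun x : ι → ZMod q => ∀ k ∈ K, ¬ Sat k (extend x)).card := by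
  choose N hN using exists_card_solutions_eq (ι := ι)
  refine ⟨K.powerset.sup N, fun q hq _ => ?_⟩
  refine charPoly_eval_eq_card K _ (fun k => {x : ι → ZMod q | Sat k (extend x)}) q ?_ ?_
  · intro k hk hu
    obtain ⟨i, hi, hj⟩ := hK k hk
    have h1 : Function.update (0 : ι → ℝ) i (k.2.2 + 1) ∈ {x : ι → ℝ | Sat k (extend x)} := by
      rw [hu]
      trivial
    simp only [Set.mem_ofPred_eq, Sat, extend, hi, Option.elim_some, Function.update_self] at h1
    rcases hk2 : k.2.1 with _ | j
    · simp [hk2] at h1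
    · have hji : j ≠ i := fun h => hj (by rw [hk2, h])
      simp [hk2, hji] at h1
  · intro B hB
    exact hN B q (lt_of_le_of_lt (Finset.le_sup (Finset.mem_powerset.mpr hB)) hq)

/-! ### Digraphical arrangements -/

/-- The equations of the hyperplanes of `digArr E a b`. -/
def digEqs [Fintype ι] (E : Finset (ι × ι)) (a b : ι → ℤ) :
    Finset (Option ι × Option ι × ℤ) :=
  ((univ.filter fun p : ι × ι => p.1 ≠ p.2).image fun p => (some p.1, some p.2, 0))
  ∪ (E.image fun p => (some p.1, some p.2, 1))
  ∪ (univ.biUnion fun i : ι => (Finset.Icc (a i) (b i)).image fun c => (some i, none, c))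

lemma image_digEqs [Fintype ι] (E : Finset (ι × ι)) (a b : ι → ℤ) :
    (digEqs E a b).image (fun k => {x : ι → ℝ | Sat k (extend x)}) = digArr E a b := by
  simp only [digEqs, digArr, Finset.image_union, Finset.image_image, Finset.biUnion_image]
  congr 3
  · simp [Function.comp_def, Sat, extend, sub_eq_iff_eq_add']
  · simp [Function.comp_def, Sat, extend, sub_eq_iff_eq_add']
  · ext i X
    simp [Sat, extend]

lemma forall_digEqs [Fintype ι] {E : Finset (ι × ι)} {a b : ι → ℤ}
    {Q : Option ι × Option ι × ℤ → Prop} :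
    (∀ k ∈ digEqs E a b, Q k) ↔ (∀ i j, i ≠ j → Q (some i, some j, 0)) ∧
      (∀ e ∈ E, Q (some e.1, some e.2, 1)) ∧
      ∀ i, ∀ c ∈ Finset.Icc (a i) (b i), Q (some i, none, c) := by
  simp only [digEqs, Finset.forall_mem_union, Finset.forall_mem_image, Finset.mem_biUnion,
    Finset.mem_filter, Finset.mem_univ, true_and]
  constructor
  · rintro ⟨⟨h1, h2⟩, h3⟩
    exact ⟨fun i j hij => h1 (x := (i, j)) hij, fun e he => h2 he,
      fun i c hc => h3 _ ⟨i, Finset.mem_image_of_mem _ hc⟩⟩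
  · rintro ⟨h1, h2, h3⟩
    refine ⟨⟨fun p hp => h1 p.1 p.2 hp, @h2⟩, ?_⟩
    rintro k ⟨i, hk⟩
    obtain ⟨c, hc, rfl⟩ := Finset.mem_image.mp hk
    exact h3 i c hc

/-- The placements `n` of the vertices at positions `0, …, q - 1` that correspond to points modulo
`q` outside the digraphical arrangement. -/
structure IsPlacement (q : ℕ) (E : Finset (ι × ι)) (a b : ι → ℤ) (n : ι → ℕ) : Prop where
  ne : ∀ i j, i ≠ j → n i ≠ n j
  edge : ∀ e ∈ E, n e.1 ≠ n e.2 + 1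
  lower : ∀ i, b i < n i
  upper : ∀ i, (n i : ℤ) < q + a i

lemma val_zmod_eq_intCast {q : ℕ} [NeZero q] (z : ZMod q) (c : ℤ) :
    z = (c : ZMod q) ↔ (z.val : ℤ) = c % q := by
  rw [← ZMod.val_intCast, Nat.cast_inj]
  exact (ZMod.val_injective q).eq_iff.symm

lemma forall_not_sat_digEqs_iff [Fintype ι] {q : ℕ} [NeZero q] {E : Finset (ι × ι)} {a b : ι → ℤ}
    (hab : ∀ i, (0 : ℤ) ∈ Finset.Icc (a i) (b i)) (hqa : ∀ i, -a i < q) (hqb : ∀ i, b i < q)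
    (hq : 1 < q) (x : ι → ZMod q) :
    (∀ k ∈ digEqs E a b, ¬ Sat k (extend x)) ↔ IsPlacement q E a b fun i => (x i).val := by
  have hweight : ∀ i, (∀ c ∈ Finset.Icc (a i) (b i), ¬ x i = (c : ZMod q)) ↔
      (b i < (x i).val ∧ ((x i).val : ℤ) < q + a i) := by
    intro i
    have hlt := ZMod.val_lt (x i)
    have h0 := Finset.mem_Icc.mp (hab i)
    have ha := hqa i
    have hb := hqb i
    simp only [val_zmod_eq_intCast, Finset.mem_Icc]
    constructor
    · intro h
      constructor
      · by_contra! hcon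
        refine h (x i).val ⟨by omega, hcon⟩ ?_
        rw [Int.emod_eq_of_lt (by omega) (by omega)]
      · by_contra! hcon
        refine h ((x i).val - q) ⟨by omega, by omega⟩ ?_
        rw [Int.sub_emod_right, Int.emod_eq_of_lt (by omega) (by omega)]
    · rintro ⟨h1, h2⟩ c ⟨hc1, hc2⟩ h
      rcases le_or_gt 0 c with hc | hc
      · rw [Int.emod_eq_of_lt hc (by omega)] at h
        omega
      · rw [← Int.add_emod_right, Int.emod_eq_of_lt (by omega) (by omega)] at h
        omega
  have hedge : ∀ i j, 0 < (x i).val → (x i = x j + 1 ↔ (x i).val = (x j).val + 1) := by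
    intro i j hi
    have : Fact (1 < q) := ⟨hq⟩
    rw [← (ZMod.val_injective q).eq_iff, ZMod.val_add, ZMod.val_one]
    have hlt := ZMod.val_lt (x j)
    rcases Nat.lt_or_ge ((x j).val + 1) q with h | h
    · rw [Nat.mod_eq_of_lt h]
    · have h1 : (x j).val + 1 = q := by omega
      have hlt' := ZMod.val_lt (x i)
      rw [h1, Nat.mod_self]
      omega
  rw [forall_digEqs]
  simp only [Sat, extend, Option.elim_some, Option.elim_none, Int.cast_zero, add_zero,
    Int.cast_one, zero_add, hweight]
  constructor
  · rintro ⟨h1, h2, h3⟩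
    refine ⟨fun i j hij h => h1 i j hij (ZMod.val_injective q h), fun e he h => ?_,
      fun i => (h3 i).1, fun i => (h3 i).2⟩
    exact h2 e he ((hedge _ _ (by omega)).mpr h)
  · rintro ⟨h1, h2, h3, h4⟩
    refine ⟨fun i j hij h => h1 i j hij (congrArg ZMod.val h), fun e he h => ?_,
      fun i => ⟨h3 i, h4 i⟩⟩
    have := h3 e.1
    have h0 := Finset.mem_Icc.mp (hab e.1)
    exact h2 e he ((hedge _ _ (by omega)).mp h)

lemma exists_charPoly_digArr_eval_eq [Fintype ι] {E : Finset (ι × ι)} {a b : ι → ℤ}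
    (hE : ∀ e ∈ E, e.1 ≠ e.2) (hab : ∀ i, (0 : ℤ) ∈ Finset.Icc (a i) (b i)) :
    ∃ N : ℕ, ∀ q > N, (charPoly (digArr E a b)).eval (q : ℤ) =
      ((Fintype.piFinset fun _ : ι => range q).filter (IsPlacement q E a b)).card := by
  obtain ⟨N, hN⟩ := exists_charPoly_eval_eq (digEqs E a b) (forall_digEqs.mpr
    ⟨fun i j hij => ⟨i, rfl, by simpa using hij.symm⟩,
      fun e he => ⟨e.1, rfl, by simpa using (hE e he).symm⟩, fun i c _ => ⟨i, rfl, by simp⟩⟩)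
  refine ⟨N + 1 + univ.sup (fun i => (a i).natAbs) + univ.sup (fun i => (b i).natAbs),
    fun q hq => ?_⟩
  have : NeZero q := ⟨by omega⟩
  have hqa : ∀ i, -a i < q := fun i => by
    have := Finset.le_sup (f := fun i => (a i).natAbs) (Finset.mem_univ i)
    omega
  have hqb : ∀ i, b i < q := fun i => by
    have := Finset.le_sup (f := fun i => (b i).natAbs) (Finset.mem_univ i)
    omega
  rw [← image_digEqs, hN q (by omega), Nat.cast_inj]
  simp only [forall_not_sat_digEqs_iff hab hqa hqb (show 1 < q by omega)]
  refine Finset.card_bij (fun x _ i => (x i).val) ?_ ?_ ?_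
  · intro x hx
    simp only [Finset.mem_filter, Finset.mem_univ, true_and] at hx
    simp [hx, ZMod.val_lt]
  · intro x _ y _ h
    ext i
    exact ZMod.val_injective q (congrFun h i)
  · intro n hn
    simp only [Finset.mem_filter, Fintype.mem_piFinset, Finset.mem_range] at hn
    have hval : (fun i => ((n i : ZMod q)).val) = n :=
      funext fun i => ZMod.val_cast_of_lt (hn.1 i)
    refine ⟨fun i => (n i : ZMod q), ?_, hval⟩
    simp only [Finset.mem_filter, Finset.mem_univ, true_and]
    rw [hval]
    exact hn.2

/-- Moving every vertex placed before the king `v` by one position is a bijection from the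
placements for `(G, ψ)` to those for the digraph obtained by king elimination. -/
lemma card_placements_keo [Fintype ι] {E : Finset (ι × ι)} {a b : ι → ℤ} {v : ι}
    (hE : ∀ e ∈ E, e.1 ≠ e.2) (hking : ∀ u, u ≠ v → (v, u) ∈ E)
    (hK0 : ∀ i, (0 : ℤ) ∈ Finset.Icc (a i) (b i))
    (hK1 : ∀ i, i ≠ v → Finset.Icc (a i + 1) (b i) ⊆ Finset.Icc (a v) (b v)) (q : ℕ) :
    ((Fintype.piFinset fun _ : ι => range q).filter (IsPlacement q E a b)).card =
    ((Fintype.piFinset fun _ : ι => range q).filter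
      (IsPlacement q (E.filter fun e => e.1 ≠ v) a
        (fun i => if i = v then b v else b i + 1))).card := by
  have h0 : ∀ i, a i ≤ 0 ∧ 0 ≤ b i := fun i => Finset.mem_Icc.mp (hK0 i)
  have hbv : ∀ i, i ≠ v → b i = 0 ∨ b i ≤ b v := fun i hi => by
    by_contra! hcon
    have := h0 i
    have := Finset.mem_Icc.mp (hK1 i hi (Finset.mem_Icc.mpr ⟨by omega, le_refl (b i)⟩))
    omega
  have hav : ∀ i, i ≠ v → a i = 0 ∨ a v ≤ a i + 1 := fun i hi => by
    by_contra! hcon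
    have := h0 i
    have := Finset.mem_Icc.mp (hK1 i hi (Finset.mem_Icc.mpr ⟨le_refl (a i + 1), by omega⟩))
    omega
  refine Finset.card_nbij' (fun n i => if n i < n v then n i + 1 else n i)
    (fun n i => if n i < n v then n i - 1 else n i) ?_ ?_ ?_ ?_
  · intro n hn
    simp only [Finset.coe_filter, Fintype.mem_piFinset, Finset.mem_range, Set.mem_ofPred_eq] at hn ⊢
    obtain ⟨hr, hne, hedge, hlow, hup⟩ := hn
    have hv := hne v
    have hk : ∀ u, u ≠ v → n v ≠ n u + 1 := fun u hu => hedge _ (hking u hu)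
    have hvr := hr v
    refine ⟨fun i => ?_, fun i j hij => ?_, fun e he => ?_, fun i => ?_, fun i => ?_⟩
    · have := hr i
      split_ifs <;> omega
    · have h1 := hne i j hij
      by_cases hi : i = v
      · subst hi
        have h2 := hk j hij.symm
        split_ifs <;> omega
      · have h2 := hk i hi
        by_cases hj : j = v
        · subst hj
          split_ifs <;> omega
        · have h3 := hk j hj
          split_ifs <;> omega
    · obtain ⟨he, hev⟩ := Finset.mem_filter.mp he
      have h1 := hedge e he
      have h2 := hk e.1 hev
      have h3 := hne e.1 v hev
      by_cases hv2 : e.2 = v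
      · rw [hv2] at h1 ⊢
        split_ifs <;> omega
      · have h4 := hk e.2 hv2
        have h5 := hne e.2 v hv2
        split_ifs <;> omega
    · have h1 := hlow i
      have h2 := hlow v
      by_cases hi : i = v
      · subst hi
        simpa using h1
      · have h3 := hbv i hi
        have h4 := hne i v hi
        have h5 := h0 v
        simp only [hi, if_false]
        split_ifs <;> omega
    · have h1 := hup i
      have h2 := hup v
      by_cases hi : i = v
      · subst hi
        simpa using h1
      · have h3 := hav i hi
        have h4 := hk i hi
        have h5 := h0 v
        split_ifs <;> omega
  · intro n hn
    simp only [Finset.coe_filter, Fintype.mem_piFinset, Finset.mem_range, Set.mem_ofPred_eq] at hn ⊢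
    obtain ⟨hr, hne, hedge, hlow, hup⟩ := hn
    have hpos : ∀ i, i ≠ v → b i + 1 < n i := fun i hi => by simpa [hi] using hlow i
    have hposv : b v < n v := by simpa using hlow v
    have h0v := h0 v
    refine ⟨fun i => ?_, fun i j hij => ?_, fun e he => ?_, fun i => ?_, fun i => ?_⟩
    · have := hr i
      split_ifs <;> omega
    · have h1 := hne i j hij
      by_cases hi : i = v
      · subst hi
        split_ifs <;> omega
      · have h2 := hpos i hi
        have h3 := h0 i
        have h4 := hne i v hi
        by_cases hj : j = v
        · subst hj
          split_ifs <;> omega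
        · have h5 := hpos j hj
          have h6 := h0 j
          have h7 := hne j v hj
          split_ifs <;> omega
    · by_cases hev : e.1 = v
      · have h1 : e.2 ≠ v := fun h => hE e he (hev.trans h.symm)
        have h2 := hne e.2 v h1
        have h3 := hpos e.2 h1
        have h4 := h0 e.2
        rw [hev]
        split_ifs <;> omega
      · have h1 := hedge e (Finset.mem_filter.mpr ⟨he, hev⟩)
        have h2 := hpos e.1 hev
        have h3 := h0 e.1
        have h4 := hne e.1 v hev
        by_cases hv2 : e.2 = v
        · rw [hv2] at h1 ⊢
          split_ifs <;> omega
        · have h5 := hpos e.2 hv2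
          have h6 := h0 e.2
          have h7 := hne e.2 v hv2
          split_ifs <;> omega
    · by_cases hi : i = v
      · subst hi
        simpa using hposv
      · have := hpos i hi
        split_ifs <;> omega
    · have := hup i
      split_ifs <;> omega
  · intro n hn
    simp only [Finset.coe_filter, Fintype.mem_piFinset, Finset.mem_range, Set.mem_ofPred_eq] at hn
    obtain ⟨-, hne, hedge, -, -⟩ := hn
    ext i
    by_cases hi : i = v
    · simp [hi]
    · have h1 := hne i v hi
      have h2 : n v ≠ n i + 1 := hedge _ (hking i hi)
      simp only [lt_irrefl, if_false]
      split_ifs <;> omega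
  · intro n hn
    simp only [Finset.coe_filter, Fintype.mem_piFinset, Finset.mem_range, Set.mem_ofPred_eq] at hn
    obtain ⟨-, hne, -, hlow, -⟩ := hn
    ext i
    by_cases hi : i = v
    · simp [hi]
    · have h1 := hne i v hi
      have h2 : b i + 1 < n i := by simpa [hi] using hlow i
      have h3 := h0 i
      simp only [lt_irrefl, if_false]
      split_ifs <;> omega

end Paper

open Paper in
/-- the king elimination operation preserves the characteristic
polynomial of ψ-digraphical arrangements, under Condition (K). -/
theorem keo_charPoly (ℓ : ℕ) (E : Finset (Fin ℓ × Fin ℓ)) (hE : ∀ e ∈ E, e.1 ≠ e.2)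
    (a b : Fin ℓ → ℤ) (v : Fin ℓ)
    (hking : ∀ u : Fin ℓ, u ≠ v → (v, u) ∈ E)
    (hK0 : ∀ i : Fin ℓ, (0 : ℤ) ∈ Finset.Icc (a i) (b i))
    (hK1 : ∀ i : Fin ℓ, i ≠ v → Finset.Icc (a i + 1) (b i) ⊆ Finset.Icc (a v) (b v)) :
    charPoly (digArr E a b)
      = charPoly (digArr (E.filter fun e => e.1 ≠ v) a
          (fun i => if i = v then b v else b i + 1)) := by
  have hE' : ∀ e ∈ E.filter fun e => e.1 ≠ v, e.1 ≠ e.2 :=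
    fun e he => hE e (Finset.mem_filter.mp he).1
  have hK0' : ∀ i, (0 : ℤ) ∈ Finset.Icc (a i) (if i = v then b v else b i + 1) := fun i => by
    have h := Finset.mem_Icc.mp (hK0 i)
    split_ifs with hi
    · exact hi ▸ hK0 i
    · exact Finset.mem_Icc.mpr ⟨h.1, by omega⟩
  obtain ⟨N, hN⟩ := exists_charPoly_digArr_eval_eq hE hK0
  obtain ⟨N', hN'⟩ := exists_charPoly_digArr_eval_eq hE' hK0'
  refine Polynomial.eq_of_infinite_eval_eq _ _
    (((Set.Ioi_infinite (max N N')).image Nat.cast_injective.injOn).mono ?_)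
  rintro _ ⟨q, hq, rfl⟩
  rw [Set.mem_Ioi, max_lt_iff] at hq
  rw [Set.mem_ofPred_eq, hN q hq.1, hN' q hq.2, card_placements_keo hE hking hK0 hK1]
  congr!
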